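/- Let (k_1, k_1^{-1}, e_1, f_1, k_2, k_2^{-1}, e_2, f_2) be a module-algebra structure of U_q(sl(3)) on the quantum 3-space A_q(3) with k_1(x_1) = qx_1, k_1(x_2) = q⁻¹x_2, k_1(x_3) = x_3, k_2(x_1) = x_1, k_2(x_2) = qx_2, k_2(x_3) = q⁻¹x_3. Then there exist a₂, b₃ ∈ ℂ∖{0} such that e_1(x_2) = a₂x_1, e_2(x_3) = b₃x_2, f_1(x_1) = a₂⁻¹x_2, f_2(x_2) = b₃⁻¹x_3, and all the remaining values e_1(x_1), e_1(x_3), e_2(x_1), e_2(x_2), f_1(x_2), f_1(x_3), f_2(x_1), f_2(x_3) are 0. Conversely, each such assignment defines a module-algebra structure of U_q(sl(3)) on A_q(3), and every such structure is isomorphic to the one with a₂ = b₃ = 1. -/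

import Mathlib

noncomputable section

open scoped BigOperators

/-- The defining relations of the quantum `n`-space `A_q(n)`:
`x_i x_j = q • (x_j x_i)` for `i > j`. -/
inductive QRel (q : ℂ) (n : ℕ) : FreeAlgebra ℂ (Fin n) → FreeAlgebra ℂ (Fin n) → Prop
  | rel (i j : Fin n) (h : j < i) :
      QRel q n (FreeAlgebra.ι ℂ i * FreeAlgebra.ι ℂ j)
        (q • (FreeAlgebra.ι ℂ j * FreeAlgebra.ι ℂ i))

/-- The quantum `n`-space `A_q(n)`. -/
abbrev QSpace (q : ℂ) (n : ℕ) : Type := RingQuot (QRel q n)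

/-- The generator `x_i` of the quantum `n`-space. -/
def Xg (q : ℂ) (n : ℕ) (i : Fin n) : QSpace q n :=
  RingQuot.mkAlgHom ℂ (QRel q n) (FreeAlgebra.ι ℂ i)

/-- The Cartan matrix of `sl(m+1)`: `a_{ii} = 2`, `a_{ij} = -1` if `|i-j| = 1`,
`a_{ij} = 0` if `|i-j| > 1`. -/
def cartan (m : ℕ) (i j : Fin m) : ℤ :=
  if i = j then 2 else if ((i : ℤ) - (j : ℤ)).natAbs = 1 then -1 else 0

/-- A module-algebra structure of `U_q(sl(m+1))` on a unital `ℂ`-algebra `A`: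
`ℂ`-linear maps `k_i` (unital algebra automorphisms with two-sided inverses `(k i).symm`),
`e_i`, `f_i` for `1 ≤ i ≤ m`, satisfying the twisted Leibniz rules and the defining
operator relations of `U_q(sl(m+1))`. -/
structure UqslMA (q : ℂ) (m : ℕ) (A : Type) [Ring A] [Algebra ℂ A] where
  k : Fin m → (A ≃ₐ[ℂ] A)
  e : Fin m → (A →ₗ[ℂ] A)
  f : Fin m → (A →ₗ[ℂ] A)
  e_mul : ∀ (i : Fin m) (a b : A), e i (a * b) = a * e i b + e i a * k i b
  f_mul : ∀ (i : Fin m) (a b : A), f i (a * b) = (k i).symm a * f i b + f i a * b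
  e_one : ∀ i : Fin m, e i 1 = 0
  f_one : ∀ i : Fin m, f i 1 = 0
  k_comm : ∀ (i j : Fin m) (a : A), k i (k j a) = k j (k i a)
  ke : ∀ (i j : Fin m) (a : A), k i (e j ((k i).symm a)) = q ^ cartan m i j • e j a
  kf : ∀ (i j : Fin m) (a : A), k i (f j ((k i).symm a)) = q ^ (-cartan m i j) • f j a
  ef : ∀ (i j : Fin m) (a : A),
      e i (f j a) - f j (e i a) =
        if i = j then (q - q⁻¹)⁻¹ • (k i a - (k i).symm a) else 0
  ee_comm : ∀ i j : Fin m, cartan m i j = 0 → ∀ a : A, e i (e j a) = e j (e i a)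
  ff_comm : ∀ i j : Fin m, cartan m i j = 0 → ∀ a : A, f i (f j a) = f j (f i a)
  serre_e : ∀ i j : Fin m, cartan m i j = -1 → ∀ a : A,
      e i (e i (e j a)) - (q + q⁻¹) • e i (e j (e i a)) + e j (e i (e i a)) = 0
  serre_f : ∀ i j : Fin m, cartan m i j = -1 → ∀ a : A,
      f i (f i (f j a)) - (q + q⁻¹) • f i (f j (f i a)) + f j (f i (f i a)) = 0

/-- Isomorphism of module-algebra structures: an algebra automorphism `ψ` of `A` with
`ψ ∘ π₁(h) ∘ ψ⁻¹ = π₂(h)` for every generator `h ∈ {k_i^{±1}, e_i, f_i}`. -/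
def UqslMA.Iso {q : ℂ} {m : ℕ} {A : Type} [Ring A] [Algebra ℂ A]
    (π₁ π₂ : UqslMA q m A) : Prop :=
  ∃ ψ : A ≃ₐ[ℂ] A,
    (∀ (i : Fin m) (a : A), ψ (π₁.k i (ψ.symm a)) = π₂.k i a) ∧
    (∀ (i : Fin m) (a : A), ψ ((π₁.k i).symm (ψ.symm a)) = (π₂.k i).symm a) ∧
    (∀ (i : Fin m) (a : A), ψ (π₁.e i (ψ.symm a)) = π₂.e i a) ∧
    (∀ (i : Fin m) (a : A), ψ (π₁.f i (ψ.symm a)) = π₂.f i a)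

/-- The generator `x_1` of the quantum 3-space. -/
def Z1 (q : ℂ) : QSpace q 3 := Xg q 3 0
/-- The generator `x_2` of the quantum 3-space. -/
def Z2 (q : ℂ) : QSpace q 3 := Xg q 3 1
/-- The generator `x_3` of the quantum 3-space. -/
def Z3 (q : ℂ) : QSpace q 3 := Xg q 3 2

/-- The `k`-action of case `(A4)|(B5)`. -/
def KCond15 (q : ℂ) (π : UqslMA q 2 (QSpace q 3)) : Prop :=
  π.k 0 (Z1 q) = q • Z1 q ∧ π.k 0 (Z2 q) = q⁻¹ • Z2 q ∧ π.k 0 (Z3 q) = Z3 q ∧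
  π.k 1 (Z1 q) = Z1 q ∧ π.k 1 (Z2 q) = q • Z2 q ∧ π.k 1 (Z3 q) = q⁻¹ • Z3 q

/-- The `e`/`f`-action of case `(A4)|(B5)` with parameters `a₂`, `b₃`. -/
def EFDesc15 (q : ℂ) (π : UqslMA q 2 (QSpace q 3)) (a₂ b₃ : ℂ) : Prop :=
  π.e 0 (Z1 q) = 0 ∧ π.e 0 (Z2 q) = a₂ • Z1 q ∧ π.e 0 (Z3 q) = 0 ∧
  π.e 1 (Z1 q) = 0 ∧ π.e 1 (Z2 q) = 0 ∧ π.e 1 (Z3 q) = b₃ • Z2 q ∧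
  π.f 0 (Z1 q) = a₂⁻¹ • Z2 q ∧ π.f 0 (Z2 q) = 0 ∧ π.f 0 (Z3 q) = 0 ∧
  π.f 1 (Z1 q) = 0 ∧ π.f 1 (Z2 q) = b₃⁻¹ • Z3 q ∧ π.f 1 (Z3 q) = 0

open scoped Polynomial

section QuantumSpace

variable {q : ℂ}

theorem Xg_mul_Xg (q : ℂ) {n : ℕ} {i j : Fin n} (h : j < i) :
    Xg q n i * Xg q n j = q • (Xg q n j * Xg q n i) := by
  have := RingQuot.mkAlgHom_rel ℂ (QRel.rel (q := q) i j h)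
  simpa [Xg] using this

theorem Z2_mul_Z1 (q : ℂ) : Z2 q * Z1 q = q • (Z1 q * Z2 q) := Xg_mul_Xg q (by decide)

theorem Z3_mul_Z1 (q : ℂ) : Z3 q * Z1 q = q • (Z1 q * Z3 q) := Xg_mul_Xg q (by decide)

theorem Z3_mul_Z2 (q : ℂ) : Z3 q * Z2 q = q • (Z2 q * Z3 q) := Xg_mul_Xg q (by decide)

/-- The universal property of the quantum `3`-space. -/
def QSpace.lift {B : Type*} [Ring B] [Algebra ℂ B] (y₁ y₂ y₃ : B)
    (h₂₁ : y₂ * y₁ = q • (y₁ * y₂)) (h₃₁ : y₃ * y₁ = q • (y₁ * y₃))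
    (h₃₂ : y₃ * y₂ = q • (y₂ * y₃)) : QSpace q 3 →ₐ[ℂ] B :=
  RingQuot.liftAlgHom ℂ ⟨FreeAlgebra.lift ℂ ![y₁, y₂, y₃], by
    rintro _ _ ⟨i, j, h⟩
    fin_cases i <;> fin_cases j <;> simp_all⟩

section lift

variable {B : Type*} [Ring B] [Algebra ℂ B] (y₁ y₂ y₃ : B)
    (h₂₁ : y₂ * y₁ = q • (y₁ * y₂)) (h₃₁ : y₃ * y₁ = q • (y₁ * y₃))
    (h₃₂ : y₃ * y₂ = q • (y₂ * y₃))

@[simp] theorem QSpace.lift_Z1 : QSpace.lift y₁ y₂ y₃ h₂₁ h₃₁ h₃₂ (Z1 q) = y₁ := by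
  simp [QSpace.lift, Z1, Xg]

@[simp] theorem QSpace.lift_Z2 : QSpace.lift y₁ y₂ y₃ h₂₁ h₃₁ h₃₂ (Z2 q) = y₂ := by
  simp [QSpace.lift, Z2, Xg]

@[simp] theorem QSpace.lift_Z3 : QSpace.lift y₁ y₂ y₃ h₂₁ h₃₁ h₃₂ (Z3 q) = y₃ := by
  simp [QSpace.lift, Z3, Xg]

end lift

theorem QSpace.gen_induction {P : QSpace q 3 → Prop} (hc : ∀ c : ℂ, P (algebraMap ℂ _ c))
    (h₁ : P (Z1 q)) (h₂ : P (Z2 q)) (h₃ : P (Z3 q))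
    (hmul : ∀ a b, P a → P b → P (a * b)) (hadd : ∀ a b, P a → P b → P (a + b))
    (a : QSpace q 3) : P a := by
  obtain ⟨b, rfl⟩ := RingQuot.mkAlgHom_surjective ℂ (QRel q 3) a
  induction b using FreeAlgebra.induction with
  | grade0 r => simpa using hc r
  | grade1 i => fin_cases i <;> assumption
  | mul a b ha hb => simpa using hmul _ _ ha hb
  | add a b ha hb => simpa using hadd _ _ ha hb

theorem QSpace.algHom_ext {B : Type*} [Ring B] [Algebra ℂ B] {φ χ : QSpace q 3 →ₐ[ℂ] B}
    (h₁ : φ (Z1 q) = χ (Z1 q)) (h₂ : φ (Z2 q) = χ (Z2 q)) (h₃ : φ (Z3 q) = χ (Z3 q)) :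
    φ = χ := by
  refine AlgHom.ext fun a ↦ ?_
  induction a using QSpace.gen_induction with
  | hc c => simp
  | h₁ => exact h₁
  | h₂ => exact h₂
  | h₃ => exact h₃
  | hmul a b ha hb => simp [ha, hb]
  | hadd a b ha hb => simp [ha, hb]

/-! ### The basis of ordered monomials -/

/-- The ordered monomial `x₁ ^ a * x₂ ^ b * x₃ ^ c` for `p = (a, b, c)`. -/
def qmono (q : ℂ) (p : ℕ × ℕ × ℕ) : QSpace q 3 := Z1 q ^ p.1 * Z2 q ^ p.2.1 * Z3 q ^ p.2.2

theorem pow_mul_pow_of_qcomm {A : Type*} [Ring A] [Algebra ℂ A] {x y : A}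
    (h : y * x = q • (x * y)) (m n : ℕ) : y ^ m * x ^ n = q ^ (m * n) • (x ^ n * y ^ m) := by
  have h1 : ∀ n : ℕ, y * x ^ n = q ^ n • (x ^ n * y) := fun n ↦ by
    induction n with
    | zero => simp
    | succ n ih =>
      rw [pow_succ, ← mul_assoc, ih, smul_mul_assoc, mul_assoc, h, mul_smul_comm, smul_smul,
        ← pow_succ, mul_assoc]
  induction m with
  | zero => simp
  | succ m ih =>
    rw [pow_succ, mul_assoc, h1, mul_smul_comm, ← mul_assoc, ih, smul_mul_assoc, smul_smul,
      mul_assoc, ← pow_add]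
    congr 2
    ring

theorem qmono_mul (p r : ℕ × ℕ × ℕ) : qmono q p * qmono q r =
    q ^ (p.2.1 * r.1 + p.2.2 * r.1 + p.2.2 * r.2.1) • qmono q (p + r) := by
  obtain ⟨a, b, c⟩ := p
  obtain ⟨a', b', c'⟩ := r
  simp only [qmono, Prod.mk_add_mk]
  calc Z1 q ^ a * Z2 q ^ b * Z3 q ^ c * (Z1 q ^ a' * Z2 q ^ b' * Z3 q ^ c')
      = Z1 q ^ a * Z2 q ^ b * (Z3 q ^ c * Z1 q ^ a') * Z2 q ^ b' * Z3 q ^ c' := by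
        simp only [mul_assoc]
    _ = q ^ (c * a') • (Z1 q ^ a * (Z2 q ^ b * Z1 q ^ a') * (Z3 q ^ c * Z2 q ^ b') *
          Z3 q ^ c') := by
        rw [pow_mul_pow_of_qcomm (Z3_mul_Z1 q)]
        simp only [mul_assoc, smul_mul_assoc, mul_smul_comm]
    _ = _ := by
        rw [pow_mul_pow_of_qcomm (Z2_mul_Z1 q), pow_mul_pow_of_qcomm (Z3_mul_Z2 q)]
        simp only [pow_add, mul_assoc, smul_mul_assoc, mul_smul_comm, smul_smul]
        congr 1
        ring

theorem qmono_zero : qmono q 0 = 1 := by simp [qmono]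

theorem Z1_eq_qmono : Z1 q = qmono q (1, 0, 0) := by simp [qmono]

theorem Z2_eq_qmono : Z2 q = qmono q (0, 1, 0) := by simp [qmono]

theorem Z3_eq_qmono : Z3 q = qmono q (0, 0, 1) := by simp [qmono]

/-- The left regular representation of the quantum `3`-space in coordinates. -/
def leftReg (q : ℂ) : QSpace q 3 →ₐ[ℂ] Module.End ℂ ((ℕ × ℕ × ℕ) →₀ ℂ) :=
  QSpace.lift
    (Finsupp.linearCombination ℂ fun p ↦ Finsupp.single ((1, 0, 0) + p) 1)
    (Finsupp.linearCombination ℂ fun p ↦ Finsupp.single ((0, 1, 0) + p) (q ^ p.1))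
    (Finsupp.linearCombination ℂ fun p ↦ Finsupp.single ((0, 0, 1) + p) (q ^ (p.1 + p.2.1)))
    (by ext ⟨a, b, c⟩ : 2; simp [pow_add, -Finsupp.single_mul])
    (by ext ⟨a, b, c⟩ : 2; simp [pow_add, mul_assoc, -Finsupp.single_mul])
    (by ext ⟨a, b, c⟩ : 2; simp [pow_add, -Finsupp.single_mul]; congr 1; ring)

theorem leftReg_qmono (p : ℕ × ℕ × ℕ) :
    leftReg q (qmono q p) (Finsupp.single 0 1) = Finsupp.single p 1 := by
  obtain ⟨a, b, c⟩ := p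
  have h3 : (leftReg q (Z3 q) ^ c) (Finsupp.single 0 1) = Finsupp.single (0, 0, c) 1 := by
    induction c with
    | zero => simp; rfl
    | succ c ih =>
      rw [pow_succ', Module.End.mul_apply, ih]
      simp [leftReg, add_comm, -Finsupp.single_mul]
  have h2 : (leftReg q (Z2 q) ^ b) (Finsupp.single (0, 0, c) 1) =
      Finsupp.single (0, b, c) 1 := by
    induction b with
    | zero => simp
    | succ b ih =>
      rw [pow_succ', Module.End.mul_apply, ih]
      simp [leftReg, add_comm, -Finsupp.single_mul]
  have h1 : (leftReg q (Z1 q) ^ a) (Finsupp.single (0, b, c) 1) =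
      Finsupp.single (a, b, c) 1 := by
    induction a with
    | zero => simp
    | succ a ih =>
      rw [pow_succ', Module.End.mul_apply, ih]
      simp [leftReg, add_comm, -Finsupp.single_mul]
  simp only [qmono, map_mul, map_pow, Module.End.mul_apply, h3, h2, h1]

theorem linearCombination_leftReg (a : QSpace q 3) (v : (ℕ × ℕ × ℕ) →₀ ℂ) :
    Finsupp.linearCombination ℂ (qmono q) (leftReg q a v) =
      a * Finsupp.linearCombination ℂ (qmono q) v := by
  induction a using QSpace.gen_induction generalizing v with
  | hc c => simp [Module.algebraMap_end_apply, Algebra.smul_def]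
  | h₁ =>
    induction v using Finsupp.induction_linear with
    | zero => simp
    | add f g hf hg => simp [hf, hg, mul_add]
    | single p c =>
      conv_rhs => rw [Z1_eq_qmono]
      simp [leftReg, qmono_mul]
  | h₂ =>
    induction v using Finsupp.induction_linear with
    | zero => simp
    | add f g hf hg => simp [hf, hg, mul_add]
    | single p c =>
      conv_rhs => rw [Z2_eq_qmono]
      simp [leftReg, qmono_mul, smul_smul, -Finsupp.single_mul]
  | h₃ =>
    induction v using Finsupp.induction_linear with
    | zero => simp
    | add f g hf hg => simp [hf, hg, mul_add]
    | single p c =>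
      conv_rhs => rw [Z3_eq_qmono]
      simp [leftReg, qmono_mul, smul_smul, -Finsupp.single_mul]
  | hmul a b ha hb => simp [ha, hb, mul_assoc]
  | hadd a b ha hb => simp [ha, hb, add_mul]

/-- The Poincaré–Birkhoff–Witt basis of the quantum `3`-space. -/
def pbw (q : ℂ) : Module.Basis (ℕ × ℕ × ℕ) ℂ (QSpace q 3) :=
  .ofRepr <| LinearEquiv.ofLinearMap
    ((LinearMap.applyₗ (Finsupp.single 0 1)).comp (leftReg q).toLinearMap)
    (Finsupp.linearCombination ℂ (qmono q))
    (by ext p : 2; simp [leftReg_qmono])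
    (by ext a; simp [linearCombination_leftReg, qmono_zero])

@[simp] theorem pbw_apply (p : ℕ × ℕ × ℕ) : pbw q p = qmono q p := by
  simp [pbw, Module.Basis.coe_ofRepr]

@[simp] theorem pbw_repr_qmono (p : ℕ × ℕ × ℕ) :
    (pbw q).repr (qmono q p) = Finsupp.single p 1 := by
  rw [← pbw_apply, Module.Basis.repr_self]

theorem QSpace.mono_induction {P : QSpace q 3 → Prop} (hmono : ∀ p, P (qmono q p))
    (hsmul : ∀ (c : ℂ) a, P a → P (c • a)) (hadd : ∀ a b, P a → P b → P (a + b))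
    (a : QSpace q 3) : P a := by
  rw [← (pbw q).linearCombination_repr a]
  induction (pbw q).repr a using Finsupp.induction_linear with
  | zero => simpa using hsmul 0 _ (hmono 0)
  | add f g hf hg => simpa using hadd _ _ hf hg
  | single p c => simpa using hsmul c _ (hmono p)

theorem qmono_mul_cancel (hq : q ≠ 0) (p : ℕ × ℕ × ℕ) {a b : QSpace q 3}
    (h : qmono q p * a = qmono q p * b) : a = b := by
  have key : ∀ z : QSpace q 3, ∀ r, (pbw q).repr (qmono q p * z) (p + r) =
      q ^ (p.2.1 * r.1 + p.2.2 * r.1 + p.2.2 * r.2.1) * (pbw q).repr z r := fun z r ↦ by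
    induction z using QSpace.mono_induction with
    | hmono s =>
      by_cases hs : s = r
      · simp [qmono_mul, hs]
      · simp [qmono_mul, hs]
    | hsmul c a ha => simp [ha, mul_left_comm]
    | hadd a b ha hb => simp [mul_add, ha, hb]
  refine (pbw q).repr.injective (Finsupp.ext fun r ↦ ?_)
  have := key a r
  rw [h, key b r] at this
  exact (mul_left_cancel₀ (pow_ne_zero _ hq) this).symm

theorem mul_qmono_cancel (hq : q ≠ 0) (p : ℕ × ℕ × ℕ) {a b : QSpace q 3}
    (h : a * qmono q p = b * qmono q p) : a = b := by
  have key : ∀ z : QSpace q 3, ∀ r, (pbw q).repr (z * qmono q p) (r + p) =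
      q ^ (r.2.1 * p.1 + r.2.2 * p.1 + r.2.2 * p.2.1) * (pbw q).repr z r := fun z r ↦ by
    induction z using QSpace.mono_induction with
    | hmono s =>
      by_cases hs : s = r
      · simp [qmono_mul, hs]
      · simp [qmono_mul, hs]
    | hsmul c a ha => simp [ha, mul_left_comm]
    | hadd a b ha hb => simp [add_mul, mul_add, ha, hb]
  refine (pbw q).repr.injective (Finsupp.ext fun r ↦ ?_)
  have := key a r
  rw [h, key b r] at this
  exact (mul_left_cancel₀ (pow_ne_zero _ hq) this).symm

/-! ### Diagonal automorphisms -/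

/-- The endomorphism `x₁ ↦ s x₁`, `x₂ ↦ t x₂`, `x₃ ↦ u x₃` of the quantum `3`-space. -/
def scale (q s t u : ℂ) : QSpace q 3 →ₐ[ℂ] QSpace q 3 :=
  QSpace.lift (s • Z1 q) (t • Z2 q) (u • Z3 q)
    (by simp only [smul_mul_smul_comm, Z2_mul_Z1, smul_smul]; congr 1; ring)
    (by simp only [smul_mul_smul_comm, Z3_mul_Z1, smul_smul]; congr 1; ring)
    (by simp only [smul_mul_smul_comm, Z3_mul_Z2, smul_smul]; congr 1; ring)

@[simp] theorem scale_Z1 (s t u : ℂ) : scale q s t u (Z1 q) = s • Z1 q := by simp [scale]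

@[simp] theorem scale_Z2 (s t u : ℂ) : scale q s t u (Z2 q) = t • Z2 q := by simp [scale]

@[simp] theorem scale_Z3 (s t u : ℂ) : scale q s t u (Z3 q) = u • Z3 q := by simp [scale]

theorem scale_scale (s t u s' t' u' : ℂ) (a : QSpace q 3) :
    scale q s t u (scale q s' t' u' a) = scale q (s * s') (t * t') (u * u') a := by
  refine DFunLike.congr_fun (f := (scale q s t u).comp (scale q s' t' u')) ?_ a
  apply QSpace.algHom_ext <;> simp [smul_smul, mul_comm]

theorem scale_one (a : QSpace q 3) : scale q 1 1 1 a = a := by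
  refine DFunLike.congr_fun (g := AlgHom.id ℂ (QSpace q 3)) ?_ a
  apply QSpace.algHom_ext <;> simp

theorem scale_qmono (s t u : ℂ) (p : ℕ × ℕ × ℕ) :
    scale q s t u (qmono q p) = (s ^ p.1 * t ^ p.2.1 * u ^ p.2.2) • qmono q p := by
  simp only [qmono, map_mul, map_pow, scale_Z1, scale_Z2, scale_Z3, smul_pow, smul_mul_smul_comm]

theorem repr_scale (s t u : ℂ) (a : QSpace q 3) (p : ℕ × ℕ × ℕ) :
    (pbw q).repr (scale q s t u a) p = s ^ p.1 * t ^ p.2.1 * u ^ p.2.2 * (pbw q).repr a p := by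
  induction a using QSpace.mono_induction with
  | hmono r =>
    by_cases h : r = p
    · simp [scale_qmono, h]
    · simp [scale_qmono, h]
  | hsmul c a ha => simp [ha, mul_left_comm]
  | hadd a b ha hb => simp [ha, hb, mul_add]

theorem eigenvalue_of_scale {s t u ν : ℂ} {a : QSpace q 3} (h : scale q s t u a = ν • a)
    {p : ℕ × ℕ × ℕ} (hp : (pbw q).repr a p ≠ 0) : s ^ p.1 * t ^ p.2.1 * u ^ p.2.2 = ν := by
  have := repr_scale s t u a p
  rw [h] at this
  simpa [hp] using this.symm

/-- The diagonal automorphism with eigenvalues `s`, `t`, `u` on the generators. -/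
def scaleEquiv (q : ℂ) (s t u : ℂˣ) : QSpace q 3 ≃ₐ[ℂ] QSpace q 3 :=
  .ofAlgHom (scale q s t u) (scale q ↑s⁻¹ ↑t⁻¹ ↑u⁻¹)
    (by ext a; simp [scale_scale, scale_one, -Units.val_inv_eq_inv_val])
    (by ext a; simp [scale_scale, scale_one, -Units.val_inv_eq_inv_val])

@[simp] theorem scaleEquiv_apply (s t u : ℂˣ) (a : QSpace q 3) :
    scaleEquiv q s t u a = scale q s t u a := rfl

@[simp] theorem scaleEquiv_symm_apply (s t u : ℂˣ) (a : QSpace q 3) :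
    (scaleEquiv q s t u).symm a = scale q ↑s⁻¹ ↑t⁻¹ ↑u⁻¹ a := rfl

theorem algEquiv_eq_scale {k : QSpace q 3 ≃ₐ[ℂ] QSpace q 3} {s t u : ℂ}
    (h₁ : k (Z1 q) = s • Z1 q) (h₂ : k (Z2 q) = t • Z2 q) (h₃ : k (Z3 q) = u • Z3 q)
    (a : QSpace q 3) : k a = scale q s t u a := by
  refine DFunLike.congr_fun (f := (k : QSpace q 3 →ₐ[ℂ] QSpace q 3)) ?_ a
  apply QSpace.algHom_ext <;> simp [*]

/-- The diagonal endomorphism with eigenvalues `q ^ i`, `q ^ j`, `q ^ l` on the generators. -/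
def qdiag (q : ℂ) (i j l : ℤ) : QSpace q 3 →ₐ[ℂ] QSpace q 3 := scale q (q ^ i) (q ^ j) (q ^ l)

@[simp] theorem qdiag_Z1 (i j l : ℤ) : qdiag q i j l (Z1 q) = q ^ i • Z1 q := scale_Z1 ..

@[simp] theorem qdiag_Z2 (i j l : ℤ) : qdiag q i j l (Z2 q) = q ^ j • Z2 q := scale_Z2 ..

@[simp] theorem qdiag_Z3 (i j l : ℤ) : qdiag q i j l (Z3 q) = q ^ l • Z3 q := scale_Z3 ..

theorem zpow_inj_of_pow_ne_one (hq : q ≠ 0) (hq' : ∀ N : ℕ, 0 < N → q ^ N ≠ 1) {m n : ℤ}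
    (h : q ^ m = q ^ n) : m = n := by
  have key : ∀ m n : ℤ, m < n → q ^ m ≠ q ^ n := fun m n hmn h ↦ by
    obtain ⟨N, hN⟩ := Int.eq_ofNat_of_zero_le (sub_nonneg.2 hmn.le)
    refine hq' N (by omega) ?_
    rw [← zpow_natCast, ← hN, zpow_sub₀ hq, h, div_self (zpow_ne_zero _ hq)]
  rcases lt_trichotomy m n with h' | h' | h'
  · exact (key _ _ h' h).elim
  · exact h'
  · exact (key _ _ h' h.symm).elim

theorem weight_of_qdiag (hq : q ≠ 0) (hq' : ∀ N : ℕ, 0 < N → q ^ N ≠ 1) {i j l n : ℤ}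
    {a : QSpace q 3} (h : qdiag q i j l a = q ^ n • a) {p : ℕ × ℕ × ℕ}
    (hp : (pbw q).repr a p ≠ 0) : i * p.1 + j * p.2.1 + l * p.2.2 = n := by
  refine zpow_inj_of_pow_ne_one hq hq' ?_
  rw [← eigenvalue_of_scale h hp]
  simp [zpow_add₀ hq, zpow_mul]

theorem eq_zero_of_repr {a : QSpace q 3} (h : ∀ p, (pbw q).repr a p ≠ 0 → False) : a = 0 := by
  refine (pbw q).repr.injective (Finsupp.ext fun p ↦ ?_)
  by_contra hp
  exact h p (by simpa using hp)

theorem Z1_mul_cancel (hq : q ≠ 0) {a b : QSpace q 3} (h : Z1 q * a = Z1 q * b) : a = b :=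
  qmono_mul_cancel hq (1, 0, 0) (by rwa [← Z1_eq_qmono])

theorem mul_Z1_cancel (hq : q ≠ 0) {a b : QSpace q 3} (h : a * Z1 q = b * Z1 q) : a = b :=
  mul_qmono_cancel hq (1, 0, 0) (by rwa [← Z1_eq_qmono])

theorem mul_Z2_cancel (hq : q ≠ 0) {a b : QSpace q 3} (h : a * Z2 q = b * Z2 q) : a = b :=
  mul_qmono_cancel hq (0, 1, 0) (by rwa [← Z2_eq_qmono])

theorem mul_Z1_eq (a : QSpace q 3) : a * Z1 q = Z1 q * qdiag q 0 1 1 a := by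
  induction a using QSpace.gen_induction with
  | hc c => simp [Algebra.commutes]
  | h₁ => simp
  | h₂ => simp [Z2_mul_Z1]
  | h₃ => simp [Z3_mul_Z1]
  | hmul a b ha hb => rw [mul_assoc, hb, ← mul_assoc, ha, mul_assoc, map_mul]
  | hadd a b ha hb => rw [add_mul, ha, hb, map_add, mul_add]

theorem Z2_mul_eq (hq : q ≠ 0) (a : QSpace q 3) : Z2 q * a = qdiag q 1 0 (-1) a * Z2 q := by
  induction a using QSpace.gen_induction with
  | hc c => simp [Algebra.commutes]
  | h₁ => simp [Z2_mul_Z1]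
  | h₂ => simp
  | h₃ => simp [Z3_mul_Z2, smul_smul, hq]
  | hmul a b ha hb => rw [← mul_assoc, ha, mul_assoc, hb, ← mul_assoc, map_mul]
  | hadd a b ha hb => rw [mul_add, ha, hb, map_add, add_mul]

theorem qdiag_qdiag (hq : q ≠ 0) (i j l i' j' l' : ℤ) (a : QSpace q 3) :
    qdiag q i j l (qdiag q i' j' l' a) = qdiag q (i + i') (j + j') (l + l') a := by
  simp [qdiag, scale_scale, zpow_add₀ hq]

theorem qdiag_zero (a : QSpace q 3) : qdiag q 0 0 0 a = a := by simp [qdiag, scale_one]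

/-! ### Polynomials in `x₁ * x₂ * x₃` -/

theorem qmono_diag_pow (hq : q ≠ 0) (n : ℕ) :
    ∃ c : ℂ, c ≠ 0 ∧ qmono q (1, 1, 1) ^ n = c • qmono q (n, n, n) := by
  induction n with
  | zero => exact ⟨1, one_ne_zero, by simp [qmono]⟩
  | succ n ih =>
    obtain ⟨c, hc, h⟩ := ih
    rw [pow_succ, h, smul_mul_assoc, qmono_mul, smul_smul]
    exact ⟨_, mul_ne_zero hc (pow_ne_zero _ hq), rfl⟩

theorem exists_aeval_of_repr (hq : q ≠ 0) (p₀ : ℕ × ℕ × ℕ) {a : QSpace q 3}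
    (h : ∀ p, (pbw q).repr a p ≠ 0 → ∃ n, p = p₀ + (n, n, n)) :
    ∃ B : ℂ[X], a = qmono q p₀ * Polynomial.aeval (qmono q (1, 1, 1)) B := by
  let W : Submodule ℂ (QSpace q 3) := LinearMap.range
    ((LinearMap.mulLeft ℂ (qmono q p₀)).comp
      (Polynomial.aeval (R := ℂ) (qmono q (1, 1, 1))).toLinearMap)
  suffices a ∈ W by
    obtain ⟨B, hB⟩ := this
    exact ⟨B, by simpa using hB.symm⟩
  rw [← (pbw q).linearCombination_repr a, Finsupp.linearCombination_apply]
  refine Submodule.sum_mem _ fun p hp ↦ Submodule.smul_mem _ _ ?_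
  obtain ⟨n, rfl⟩ := h p (by simpa using hp)
  obtain ⟨c, hc, h⟩ := qmono_diag_pow hq n
  refine ⟨Polynomial.C (q ^ (p₀.2.1 * n + p₀.2.2 * n + p₀.2.2 * n) * c)⁻¹ * Polynomial.X ^ n, ?_⟩
  simp only [LinearMap.comp_apply, AlgHom.toLinearMap_apply, LinearMap.mulLeft_apply, map_mul,
    map_pow, Polynomial.aeval_X, Polynomial.aeval_C, h, ← Algebra.smul_def, mul_smul_comm,
    qmono_mul, smul_smul, pbw_apply]
  convert one_smul ℂ _
  field_simp

theorem aeval_qmono_injective (hq : q ≠ 0) :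
    Function.Injective (Polynomial.aeval (R := ℂ) (qmono q (1, 1, 1))) := by
  refine (injective_iff_map_eq_zero _).2 fun B hB ↦ Polynomial.ext fun n ↦ ?_
  choose c hc h using qmono_diag_pow hq
  have : (pbw q).repr (Polynomial.aeval (qmono q (1, 1, 1)) B) (n, n, n) = c n * B.coeff n := by
    rw [Polynomial.aeval_eq_sum_range' (Nat.lt_succ_of_le (le_max_left B.natDegree n))]
    simp [h, Finsupp.single_apply, mul_comm]
  rw [hB] at this
  simpa [hc] using this

theorem aeval_smul_eq_comp {A : Type*} [Ring A] [Algebra ℂ A] (c : ℂ) (x : A) (B : ℂ[X]) :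
    Polynomial.aeval (c • x) B =
      Polynomial.aeval x (B.comp (Polynomial.C c * Polynomial.X)) := by
  rw [Polynomial.aeval_comp]
  simp [Algebra.smul_def]

theorem qdiag_aeval {i j l : ℤ} (B : ℂ[X]) :
    qdiag q i j l (Polynomial.aeval (qmono q (1, 1, 1)) B) =
      Polynomial.aeval (qmono q (1, 1, 1))
        (B.comp (Polynomial.C (q ^ i * q ^ j * q ^ l) * Polynomial.X)) := by
  rw [← aeval_smul_eq_comp, ← Polynomial.aeval_algHom_apply]
  simp [qdiag, scale_qmono]

theorem sq_zpow_ne (hq : q ≠ 0) (hq' : ∀ N : ℕ, 0 < N → q ^ N ≠ 1) (n : ℕ) :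
    (q ^ 2) ^ n - (q ^ 2)⁻¹ ≠ 0 := fun h ↦ by
  refine hq' (2 * n + 2) (by omega) ?_
  rw [sub_eq_zero] at h
  rw [pow_add, pow_mul, h]
  field_simp

theorem exists_comp_sub_eq (hq : q ≠ 0) (hq' : ∀ N : ℕ, 0 < N → q ^ N ≠ 1) (R : ℂ[X]) :
    ∃ P : ℂ[X], P.comp (Polynomial.C (q ^ 2) * Polynomial.X) - Polynomial.C (q ^ 2)⁻¹ * P = R := by
  induction R using Polynomial.induction_on' with
  | add R S hR hS =>
    obtain ⟨P, rfl⟩ := hR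
    obtain ⟨Q, rfl⟩ := hS
    exact ⟨P + Q, by simp; ring⟩
  | monomial n c =>
    refine ⟨Polynomial.monomial n (c / ((q ^ 2) ^ n - (q ^ 2)⁻¹)), Polynomial.ext fun m ↦ ?_⟩
    have := sq_zpow_ne hq hq' n
    rw [Polynomial.coeff_sub, Polynomial.comp_C_mul_X_coeff, Polynomial.coeff_C_mul]
    simp only [Polynomial.coeff_monomial]
    split_ifs with h
    · subst h
      rw [mul_comm (q ^ 2)⁻¹, ← mul_sub, div_mul_cancel₀ _ this]
    · simp

theorem eq_C_of_comp_sub_eq_one (hq : q ≠ 0) (hq' : ∀ N : ℕ, 0 < N → q ^ N ≠ 1) {G : ℂ[X]}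
    (h : G.comp (Polynomial.C (q ^ 2) * Polynomial.X) - Polynomial.C (q ^ 2)⁻¹ * G = 1) :
    ∃ c, G = Polynomial.C c ∧ c * (1 - (q ^ 2)⁻¹) = 1 := by
  have hc : ∀ n, G.coeff n * ((q ^ 2) ^ n - (q ^ 2)⁻¹) = if n = 0 then 1 else 0 := fun n ↦ by
    have := congrArg (fun P ↦ P.coeff n) h
    simp only [Polynomial.coeff_sub, Polynomial.comp_C_mul_X_coeff, Polynomial.coeff_C_mul,
      Polynomial.coeff_one] at this
    rw [← this]
    ring
  refine ⟨G.coeff 0, Polynomial.ext fun n ↦ ?_, by simpa using hc 0⟩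
  rw [Polynomial.coeff_C]
  split_ifs with hn
  · rw [hn]
  · simpa [hn, sq_zpow_ne hq hq' n] using hc n

/-! ### Rank one -/

/-- The action of one node: a pair `E`, `F` of skew derivations of the quantum `3`-space, with
`k = diag(q, q⁻¹, 1)`, spanning together with `k` a copy of `U_q(sl(2))`, and
with weights as prescribed by `diag(1, q, q⁻¹)`. -/
structure IsNode (q : ℂ) (E F : QSpace q 3 →ₗ[ℂ] QSpace q 3) : Prop where
  e_mul : ∀ a b, E (a * b) = a * E b + E a * qdiag q 1 (-1) 0 b
  f_mul : ∀ a b, F (a * b) = qdiag q (-1) 1 0 a * F b + F a * b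
  k_e : ∀ a, qdiag q 1 (-1) 0 (E a) = q ^ (2 : ℤ) • E (qdiag q 1 (-1) 0 a)
  k_f : ∀ a, qdiag q 1 (-1) 0 (F a) = q ^ (-2 : ℤ) • F (qdiag q 1 (-1) 0 a)
  l_e : ∀ a, qdiag q 0 1 (-1) (E a) = q ^ (-1 : ℤ) • E (qdiag q 0 1 (-1) a)
  l_f : ∀ a, qdiag q 0 1 (-1) (F a) = q ^ (1 : ℤ) • F (qdiag q 0 1 (-1) a)
  e_f : ∀ a, E (F a) - F (E a) =
    (q - q⁻¹)⁻¹ • (qdiag q 1 (-1) 0 a - qdiag q (-1) 1 0 a)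

theorem eq_zero_of_skew_derivation (hq : q ≠ 0) (hq' : ∀ N : ℕ, 0 < N → q ^ N ≠ 1)
    {D : QSpace q 3 →ₗ[ℂ] QSpace q 3}
    (hD : ∀ a b, D (a * b) = qdiag q (-1) 1 0 a * D b + D a * qdiag q 0 1 1 b)
    (h₁ : D (Z1 q) = 0) (h₂ : D (Z2 q) = 0)
    (h₃ : qdiag q 1 (-1) 0 (D (Z3 q)) = q ^ (-1 : ℤ) • D (Z3 q)) : D = 0 := by
  have hcomm : D (Z3 q) * Z1 q = Z1 q * D (Z3 q) := by
    have := congrArg D (Z3_mul_Z1 q)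
    rw [map_smul, hD, hD, h₁] at this
    simpa [smul_smul, hq] using this
  have h₃' : D (Z3 q) = 0 := eq_zero_of_repr fun p hp ↦ by
    have e1 := weight_of_qdiag hq hq' h₃ hp
    have e2 := weight_of_qdiag hq hq' (i := 0) (j := 1) (l := 1) (n := 0)
      (by simpa using Z1_mul_cancel hq ((mul_Z1_eq _).symm.trans hcomm)) hp
    omega
  refine LinearMap.ext fun a ↦ ?_
  induction a using QSpace.gen_induction with
  | hc c =>
    have h := hD 1 1
    simp only [mul_one, map_one, one_mul, left_eq_add] at h
    rw [Algebra.algebraMap_eq_smul_one, map_smul, h, smul_zero, LinearMap.zero_apply]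
  | h₁ => simpa using h₁
  | h₂ => simpa using h₂
  | h₃ => simpa using h₃'
  | hmul a b ha hb => simp_all
  | hadd a b ha hb => simp_all

section IsNode

variable {E F : QSpace q 3 →ₗ[ℂ] QSpace q 3}

theorem IsNode.f_Z2 (h : IsNode q E F) (hq : q ≠ 0) (hq' : ∀ N : ℕ, 0 < N → q ^ N ≠ 1) :
    F (Z2 q) = 0 := by
  have h₁ : Z2 q * F (Z1 q) = F (Z1 q) * Z2 q := by
    rw [Z2_mul_eq hq, show qdiag q 1 0 (-1) (F (Z1 q)) = F (Z1 q) from ?_]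
    have := qdiag_qdiag hq 1 (-1) 0 0 1 (-1) (F (Z1 q))
    rw [h.l_f, map_smul, h.k_f] at this
    simp only [qdiag_Z1, map_smul, smul_smul, ← zpow_add₀ hq] at this
    simpa using this.symm
  have hcomm : F (Z2 q) * Z1 q = Z1 q * F (Z2 q) := by
    have := congrArg F (Z2_mul_Z1 q)
    rw [map_smul, h.f_mul, h.f_mul] at this
    simp only [qdiag_Z1, qdiag_Z2, smul_mul_assoc, zpow_neg_one, zpow_one, smul_add, smul_smul,
      mul_inv_cancel₀ hq, one_smul, h₁] at this
    rw [add_comm] at this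
    exact add_right_cancel this
  refine eq_zero_of_repr fun p hp ↦ ?_
  have e1 := weight_of_qdiag hq hq' (i := 1) (j := -1) (l := 0) (n := -3)
    (by rw [h.k_f, qdiag_Z2, map_smul, smul_smul, ← zpow_add₀ hq]; rfl) hp
  have e2 := weight_of_qdiag hq hq' (i := 0) (j := 1) (l := 1) (n := 0)
    (by simpa using Z1_mul_cancel hq ((mul_Z1_eq _).symm.trans hcomm)) hp
  omega

theorem IsNode.f_e_Z2 (h : IsNode q E F) (hq : q ≠ 0) (hq' : ∀ N : ℕ, 0 < N → q ^ N ≠ 1) :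
    F (E (Z2 q)) = Z2 q := by
  have h₀ : q - q⁻¹ ≠ 0 := fun h ↦ hq' 2 two_pos (by
    rw [sub_eq_zero] at h
    rw [pow_two]
    nth_rewrite 1 [h]
    exact inv_mul_cancel₀ hq)
  have := h.e_f (Z2 q)
  rw [h.f_Z2 hq hq', map_zero, zero_sub, qdiag_Z2, qdiag_Z2,
    ← sub_smul (q ^ (-1 : ℤ)) (q ^ (1 : ℤ)) (Z2 q),
    smul_smul, neg_eq_iff_eq_neg, ← neg_smul] at this
  rw [this]
  convert one_smul ℂ (Z2 q)
  rw [zpow_neg_one, zpow_one, ← neg_sub q, mul_neg, neg_neg, inv_mul_cancel₀ h₀]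

theorem IsNode.exists_e_Z2 (h : IsNode q E F) (hq : q ≠ 0)
    (hq' : ∀ N : ℕ, 0 < N → q ^ N ≠ 1) :
    ∃ B : ℂ[X], E (Z2 q) = Z1 q * Polynomial.aeval (qmono q (1, 1, 1)) B := by
  rw [Z1_eq_qmono]
  refine exists_aeval_of_repr hq _ fun p hp ↦ ?_
  have e1 := weight_of_qdiag hq hq' (i := 1) (j := -1) (l := 0) (n := 1)
    (by rw [h.k_e, qdiag_Z2, map_smul, smul_smul, ← zpow_add₀ hq]; rfl) hp
  have e2 := weight_of_qdiag hq hq' (i := 0) (j := 1) (l := -1) (n := 0)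
    (by rw [h.l_e, qdiag_Z2, map_smul, smul_smul, ← zpow_add₀ hq]; rfl) hp
  refine ⟨p.2.1, ?_⟩
  ext <;> simp <;> omega

theorem IsNode.exists_f_Z1 (h : IsNode q E F) (hq : q ≠ 0)
    (hq' : ∀ N : ℕ, 0 < N → q ^ N ≠ 1) :
    ∃ R : ℂ[X], F (Z1 q) = Z2 q * Polynomial.aeval (qmono q (1, 1, 1)) R := by
  rw [Z2_eq_qmono]
  refine exists_aeval_of_repr hq _ fun p hp ↦ ?_
  have e1 := weight_of_qdiag hq hq' (i := 1) (j := -1) (l := 0) (n := -1)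
    (by rw [h.k_f, qdiag_Z1, map_smul, smul_smul, ← zpow_add₀ hq]; rfl) hp
  have e2 := weight_of_qdiag hq hq' (i := 0) (j := 1) (l := -1) (n := 1)
    (by rw [h.l_f, qdiag_Z1, map_smul, smul_smul, ← zpow_add₀ hq]; rfl) hp
  refine ⟨p.1, ?_⟩
  ext <;> simp <;> omega

theorem aeval_mul_Z1 (P : ℂ[X]) :
    Polynomial.aeval (qmono q (1, 1, 1)) P * Z1 q = Z1 q *
      Polynomial.aeval (qmono q (1, 1, 1)) (P.comp (Polynomial.C (q ^ 2) * Polynomial.X)) := by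
  rw [mul_Z1_eq, qdiag_aeval]
  simp [pow_two]

theorem aeval_mul_Z2 (hq : q ≠ 0) (P : ℂ[X]) :
    Polynomial.aeval (qmono q (1, 1, 1)) P * Z2 q =
      Z2 q * Polynomial.aeval (qmono q (1, 1, 1)) P := by
  rw [Z2_mul_eq hq, qdiag_aeval]
  simp [hq]

/-- The action of `F` is inner in the localization at `x₁`. -/
theorem IsNode.exists_f_mul_Z1 (h : IsNode q E F) (hq : q ≠ 0)
    (hq' : ∀ N : ℕ, 0 < N → q ^ N ≠ 1) :
    ∃ P : ℂ[X], ∀ a, F a * Z1 q =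
      Z2 q * Polynomial.aeval (qmono q (1, 1, 1)) P * qdiag q 0 1 1 a -
        qdiag q (-1) 1 0 a * (Z2 q * Polynomial.aeval (qmono q (1, 1, 1)) P) := by
  obtain ⟨R, hR⟩ := h.exists_f_Z1 hq hq'
  obtain ⟨P, hP⟩ := exists_comp_sub_eq hq hq'
    (R.comp (Polynomial.C (q ^ 2) * Polynomial.X))
  refine ⟨P, ?_⟩
  set p := Z2 q * Polynomial.aeval (qmono q (1, 1, 1)) P with hp
  let D : QSpace q 3 →ₗ[ℂ] QSpace q 3 := (LinearMap.mulRight ℂ (Z1 q)).comp F -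
    ((LinearMap.mulLeft ℂ p).comp (qdiag q 0 1 1).toLinearMap -
      (LinearMap.mulRight ℂ p).comp (qdiag q (-1) 1 0).toLinearMap)
  have hD : ∀ a, D a = F a * Z1 q - (p * qdiag q 0 1 1 a - qdiag q (-1) 1 0 a * p) :=
    fun a ↦ rfl
  suffices D = 0 from fun a ↦ sub_eq_zero.1 (by rw [← hD, this, LinearMap.zero_apply])
  have hkp : qdiag q 1 (-1) 0 p = q ^ (-1 : ℤ) • p := by
    rw [hp, map_mul, qdiag_aeval, qdiag_Z2, smul_mul_assoc]
    simp [hq]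
  refine eq_zero_of_skew_derivation hq hq' (fun a b ↦ ?_) ?_ ?_ ?_
  · rw [hD, hD, hD, h.f_mul, add_mul, mul_assoc, mul_assoc (F a), mul_Z1_eq b, map_mul, map_mul]
    simp only [sub_mul, mul_sub, mul_assoc]
    abel
  · have e1 : F (Z1 q) * Z1 q = Z2 q * Z1 q * Polynomial.aeval (qmono q (1, 1, 1))
        (R.comp (Polynomial.C (q ^ 2) * Polynomial.X)) := by
      rw [hR, mul_assoc, aeval_mul_Z1, mul_assoc]
    have e2 : Z1 q * p = q⁻¹ • (Z2 q * Z1 q * Polynomial.aeval (qmono q (1, 1, 1)) P) := by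
      rw [hp, Z2_mul_Z1, smul_mul_assoc, smul_smul, inv_mul_cancel₀ hq, one_smul, mul_assoc]
    have e3 : p * Z1 q = Z2 q * Z1 q * Polynomial.aeval (qmono q (1, 1, 1))
        (P.comp (Polynomial.C (q ^ 2) * Polynomial.X)) := by
      rw [hp, mul_assoc, aeval_mul_Z1, mul_assoc]
    rw [hD, e1, ← hP]
    simp only [qdiag_Z1, zpow_zero, one_smul, e3, smul_mul_assoc, e2, map_sub, map_mul, mul_sub,
      Polynomial.aeval_C, ← Algebra.smul_def, mul_smul_comm, smul_smul]
    rw [sub_eq_zero, zpow_neg_one, ← mul_inv, ← pow_two]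
  · have : Z2 q * p = p * Z2 q := by rw [hp, mul_assoc, aeval_mul_Z2 hq]
    simp [hD, h.f_Z2 hq hq', this]
  · rw [hD]
    simp only [map_sub, map_mul, hkp, h.k_f, qdiag_Z1, qdiag_Z3, smul_sub,
      smul_mul_assoc, mul_smul_comm, map_smul, smul_smul, ← zpow_add₀ hq]
    norm_num

theorem IsNode.eval (h : IsNode q E F) (hq : q ≠ 0) (hq' : ∀ N : ℕ, 0 < N → q ^ N ≠ 1) :
    ∃ c : ℂ, c ≠ 0 ∧ E (Z1 q) = 0 ∧ E (Z2 q) = c • Z1 q ∧ E (Z3 q) = 0 ∧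
      F (Z1 q) = c⁻¹ • Z2 q ∧ F (Z2 q) = 0 ∧ F (Z3 q) = 0 := by
  obtain ⟨B, hB⟩ := h.exists_e_Z2 hq hq'
  obtain ⟨P, hP⟩ := h.exists_f_mul_Z1 hq hq'
  have hPB : (P * B).comp (Polynomial.C (q ^ 2) * Polynomial.X) -
      Polynomial.C (q ^ 2)⁻¹ * (P * B) = 1 := by
    apply aeval_qmono_injective hq
    rw [map_one]
    apply Z1_mul_cancel hq
    apply qmono_mul_cancel hq (0, 1, 0)
    rw [← Z2_eq_qmono, mul_one]
    have h1 := hP (E (Z2 q))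
    rw [h.f_e_Z2 hq hq', hB] at h1
    have e1 : Z1 q * Polynomial.aeval (qmono q (1, 1, 1)) B *
        (Z2 q * Polynomial.aeval (qmono q (1, 1, 1)) P) =
        q⁻¹ • (Z2 q * (Z1 q * Polynomial.aeval (qmono q (1, 1, 1)) (P * B))) := by
      rw [← mul_assoc (Z2 q), Z2_mul_Z1, smul_mul_assoc, smul_smul, inv_mul_cancel₀ hq, one_smul,
        mul_comm P, map_mul, mul_assoc, ← mul_assoc _ (Z2 q), aeval_mul_Z2 hq]
      simp only [mul_assoc]
    have e2 : Z2 q * Polynomial.aeval (qmono q (1, 1, 1)) P * qdiag q 0 1 1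
        (Z1 q * Polynomial.aeval (qmono q (1, 1, 1)) B) =
        Z2 q * (Z1 q * Polynomial.aeval (qmono q (1, 1, 1))
          ((P * B).comp (Polynomial.C (q ^ 2) * Polynomial.X))) := by
      rw [map_mul, qdiag_aeval, qdiag_Z1, zpow_zero, one_smul, mul_assoc, ← mul_assoc _ (Z1 q),
        aeval_mul_Z1, Polynomial.mul_comp, map_mul]
      simp [mul_assoc, pow_two]
    have e3 : qdiag q (-1) 1 0 (Z1 q * Polynomial.aeval (qmono q (1, 1, 1)) B) =
        q⁻¹ • (Z1 q * Polynomial.aeval (qmono q (1, 1, 1)) B) := by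
      rw [map_mul, qdiag_aeval, qdiag_Z1]
      simp [hq]
    rw [h1, e2, e3, smul_mul_assoc, e1, map_sub, mul_sub, mul_sub, map_mul, Polynomial.aeval_C,
      ← Algebra.smul_def, mul_smul_comm, mul_smul_comm, smul_smul, pow_two, mul_inv]
  obtain ⟨c, hc, hc'⟩ := eq_C_of_comp_sub_eq_one hq hq' hPB
  have hu : IsUnit (P * B) :=
    hc ▸ Polynomial.isUnit_C.2 (left_ne_zero_of_mul (hc' ▸ one_ne_zero)).isUnit
  obtain ⟨b, hb, rfl⟩ := Polynomial.isUnit_iff.1 (isUnit_of_mul_isUnit_right hu)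
  obtain ⟨d, -, rfl⟩ := Polynomial.isUnit_iff.1 (isUnit_of_mul_isUnit_left hu)
  rw [← Polynomial.C_mul, Polynomial.C_inj] at hc
  subst hc
  simp only [Polynomial.aeval_C, ← Algebra.commutes, ← Algebra.smul_def] at hB hP
  have hq2 : q ^ 2 ≠ 1 := hq' 2 two_pos
  refine ⟨b, hb.ne_zero, ?_, hB, ?_, ?_, h.f_Z2 hq hq', ?_⟩
  · have hw : Z2 q * E (Z1 q) = q ^ 2 • (E (Z1 q) * Z2 q) := by
      have := qdiag_qdiag hq 1 (-1) 0 0 1 (-1) (E (Z1 q))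
      rw [h.l_e, map_smul, h.k_e] at this
      rw [Z2_mul_eq hq, ← smul_mul_assoc]
      congr 1
      simp only [qdiag_Z1, map_smul, smul_smul, ← zpow_add₀ hq] at this
      simpa using this.symm
    have := congrArg E (Z2_mul_Z1 q)
    rw [map_smul, h.e_mul, h.e_mul, hB, hw, qdiag_Z1, qdiag_Z2] at this
    simp only [smul_mul_assoc, mul_smul_comm, smul_smul, smul_add, zpow_neg_one, zpow_one,
      mul_inv_cancel₀ hq, one_smul] at this
    rw [add_comm, add_right_inj, ← sub_eq_zero] at this
    have h0 : (q ^ 2 - 1) • (E (Z1 q) * Z2 q) = 0 := by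
      rw [sub_smul (q ^ 2) 1 (E (Z1 q) * Z2 q), one_smul, this]
    rw [smul_eq_zero_iff_right (sub_ne_zero.2 hq2)] at h0
    exact mul_Z2_cancel hq (h0.trans (zero_mul _).symm)
  · have hw : Z2 q * E (Z3 q) = E (Z3 q) * Z2 q := by
      have := qdiag_qdiag hq 1 (-1) 0 0 1 (-1) (E (Z3 q))
      rw [h.l_e, map_smul, h.k_e] at this
      rw [Z2_mul_eq hq]
      congr 1
      simp only [qdiag_Z3, map_smul, smul_smul, ← zpow_add₀ hq] at this
      simpa using this.symm
    have := congrArg E (Z3_mul_Z2 q)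
    rw [map_smul, h.e_mul, h.e_mul, hB, hw, qdiag_Z2, qdiag_Z3] at this
    simp only [smul_mul_assoc, mul_smul_comm, smul_smul, smul_add, zpow_neg_one, zpow_zero,
      mul_comm b, one_smul, Z3_mul_Z1] at this
    rw [add_comm, add_left_inj, ← sub_eq_zero] at this
    have h0 : (q⁻¹ - q) • (E (Z3 q) * Z2 q) = 0 := by
      rw [sub_smul q⁻¹ q (E (Z3 q) * Z2 q), this]
    have hne : q⁻¹ - q ≠ 0 := fun h ↦ hq2 (by
      rw [sub_eq_zero] at h
      rw [pow_two]
      nth_rewrite 1 [← h]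
      exact inv_mul_cancel₀ hq)
    rw [smul_eq_zero_iff_right hne] at h0
    exact mul_Z2_cancel hq (h0.trans (zero_mul _).symm)
  · apply mul_Z1_cancel hq
    rw [hP, qdiag_Z1, qdiag_Z1, zpow_zero, one_smul, zpow_neg_one, smul_mul_smul_comm,
      smul_mul_assoc, smul_mul_assoc, Z2_mul_Z1, smul_smul, smul_smul, ← sub_smul]
    congr 1
    have hb' := hb.ne_zero
    field_simp at hc' ⊢
    linear_combination hc'
  · apply mul_Z1_cancel hq
    rw [hP, qdiag_Z3, qdiag_Z3, zpow_zero, one_smul, zpow_one, smul_mul_smul_comm,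
      mul_smul_comm, Z3_mul_Z2, smul_smul, mul_comm d, sub_self, zero_mul]

end IsNode

/-! ### The reversal anti-automorphism -/

/-- The anti-automorphism of the quantum `3`-space exchanging `x₁` and `x₃`. -/
def rev (q : ℂ) : QSpace q 3 →ₗ[ℂ] QSpace q 3 :=
  (MulOpposite.opLinearEquiv ℂ).symm.toLinearMap ∘ₗ
    (QSpace.lift (q := q) (MulOpposite.op (Z3 q)) (MulOpposite.op (Z2 q)) (MulOpposite.op (Z1 q))
      (by simp [← MulOpposite.op_mul, ← MulOpposite.op_smul, Z3_mul_Z2])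
      (by simp [← MulOpposite.op_mul, ← MulOpposite.op_smul, Z3_mul_Z1])
      (by simp [← MulOpposite.op_mul, ← MulOpposite.op_smul, Z2_mul_Z1])).toLinearMap

theorem rev_mul (a b : QSpace q 3) : rev q (a * b) = rev q b * rev q a := by
  simp [rev]

@[simp] theorem rev_algebraMap (c : ℂ) :
    rev q (algebraMap ℂ _ c) = algebraMap ℂ _ c := by
  simp [rev]

@[simp] theorem rev_Z1 : rev q (Z1 q) = Z3 q := by simp [rev]

@[simp] theorem rev_Z2 : rev q (Z2 q) = Z2 q := by simp [rev]

@[simp] theorem rev_Z3 : rev q (Z3 q) = Z1 q := by simp [rev]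

@[simp] theorem rev_rev (a : QSpace q 3) : rev q (rev q a) = a := by
  induction a using QSpace.gen_induction with
  | hc c => simp
  | h₁ => simp
  | h₂ => simp
  | h₃ => simp
  | hmul a b ha hb => simp [rev_mul, ha, hb]
  | hadd a b ha hb => simp [ha, hb]

theorem rev_qdiag (i j l : ℤ) (a : QSpace q 3) :
    rev q (qdiag q i j l a) = qdiag q l j i (rev q a) := by
  induction a using QSpace.gen_induction with
  | hc c => simp
  | h₁ => simp
  | h₂ => simp
  | h₃ => simp
  | hmul a b ha hb => simp [rev_mul, ha, hb]
  | hadd a b ha hb => simp [ha, hb]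

/-! ### Classification -/

theorem cartan_two_zero_zero : cartan 2 0 0 = 2 := by decide

theorem cartan_two_zero_one : cartan 2 0 1 = -1 := by decide

theorem cartan_two_one_zero : cartan 2 1 0 = -1 := by decide

theorem cartan_two_one_one : cartan 2 1 1 = 2 := by decide

namespace KCond15

variable {π : UqslMA q 2 (QSpace q 3)}

theorem k_zero (h : KCond15 q π) (a : QSpace q 3) : π.k 0 a = qdiag q 1 (-1) 0 a := by
  simpa [qdiag] using algEquiv_eq_scale h.1 h.2.1 (h.2.2.1.trans (one_smul ℂ _).symm) a

theorem k_one (h : KCond15 q π) (a : QSpace q 3) : π.k 1 a = qdiag q 0 1 (-1) a := by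
  simpa [qdiag] using
    algEquiv_eq_scale (h.2.2.2.1.trans (one_smul ℂ _).symm) h.2.2.2.2.1 h.2.2.2.2.2 a

theorem k_zero_symm (hq : q ≠ 0) (h : KCond15 q π) (a : QSpace q 3) :
    (π.k 0).symm a = qdiag q (-1) 1 0 a := by
  rw [AlgEquiv.symm_apply_eq, h.k_zero, qdiag_qdiag hq]
  exact (qdiag_zero a).symm

theorem k_one_symm (hq : q ≠ 0) (h : KCond15 q π) (a : QSpace q 3) :
    (π.k 1).symm a = qdiag q 0 (-1) 1 a := by
  rw [AlgEquiv.symm_apply_eq, h.k_one, qdiag_qdiag hq]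
  exact (qdiag_zero a).symm

theorem isNode (hq : q ≠ 0) (h : KCond15 q π) : IsNode q (π.e 0) (π.f 0) where
  e_mul a b := by rw [π.e_mul, h.k_zero]
  f_mul a b := by rw [π.f_mul, h.k_zero_symm hq]
  k_e a := by
    have := π.ke 0 0 (π.k 0 a)
    rwa [AlgEquiv.symm_apply_apply, h.k_zero, h.k_zero, cartan_two_zero_zero] at this
  k_f a := by
    have := π.kf 0 0 (π.k 0 a)
    rwa [AlgEquiv.symm_apply_apply, h.k_zero, h.k_zero, cartan_two_zero_zero] at this
  l_e a := by
    have := π.ke 1 0 (π.k 1 a)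
    rwa [AlgEquiv.symm_apply_apply, h.k_one, h.k_one, cartan_two_one_zero] at this
  l_f a := by
    have := π.kf 1 0 (π.k 1 a)
    rwa [AlgEquiv.symm_apply_apply, h.k_one, h.k_one, cartan_two_one_zero, neg_neg] at this
  e_f a := by
    rw [π.ef, if_pos rfl, h.k_zero, h.k_zero_symm hq]

theorem symm_apply_of_conj (hq : q ≠ 0) {k : QSpace q 3 ≃ₐ[ℂ] QSpace q 3}
    {D : QSpace q 3 →ₗ[ℂ] QSpace q 3} {m n : ℤ} (hmn : n + m = 0)
    (h : ∀ a, k (D (k.symm a)) = q ^ m • D a) (a : QSpace q 3) :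
    k.symm (D a) = q ^ n • D (k.symm a) := by
  rw [AlgEquiv.symm_apply_eq, map_smul, h, smul_smul, ← zpow_add₀ hq, hmn, zpow_zero, one_smul]

theorem isNode_rev (hq : q ≠ 0) (h : KCond15 q π) :
    IsNode q (rev q ∘ₗ π.f 1 ∘ₗ rev q) (rev q ∘ₗ π.e 1 ∘ₗ rev q) where
  e_mul a b := by
    simp only [LinearMap.comp_apply, rev_mul, π.f_mul, map_add, h.k_one_symm hq, rev_qdiag,
      rev_rev]
    rw [add_comm]
  f_mul a b := by
    simp only [LinearMap.comp_apply, rev_mul, π.e_mul, map_add, h.k_one, rev_qdiag, rev_rev]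
    rw [add_comm]
  k_e a := by
    have := symm_apply_of_conj hq (n := 2) (by rw [cartan_two_one_one]; rfl) (π.kf 1 1) (rev q a)
    rw [h.k_one_symm hq, h.k_one_symm hq] at this
    simp only [LinearMap.comp_apply, rev_qdiag, ← map_smul, ← this]
  k_f a := by
    have := symm_apply_of_conj hq (n := -2) (by rw [cartan_two_one_one]; rfl) (π.ke 1 1) (rev q a)
    rw [h.k_one_symm hq, h.k_one_symm hq] at this
    simp only [LinearMap.comp_apply, rev_qdiag, ← map_smul, ← this]
  l_e a := by
    have := symm_apply_of_conj hq (n := -1) (by rw [cartan_two_zero_one]; rfl) (π.kf 0 1) (rev q a)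
    rw [h.k_zero_symm hq, h.k_zero_symm hq] at this
    simp only [LinearMap.comp_apply, rev_qdiag, ← map_smul, ← this]
  l_f a := by
    have := symm_apply_of_conj hq (n := 1) (by rw [cartan_two_zero_one]; rfl) (π.ke 0 1) (rev q a)
    rw [h.k_zero_symm hq, h.k_zero_symm hq] at this
    simp only [LinearMap.comp_apply, rev_qdiag, ← map_smul, ← this]
  e_f a := by
    have := congrArg (rev q) (π.ef 1 1 (rev q a))
    rw [if_pos rfl, h.k_one, h.k_one_symm hq, map_sub, map_smul, map_sub, rev_qdiag, rev_qdiag,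
      rev_rev] at this
    simp only [LinearMap.comp_apply, rev_rev]
    rw [← neg_sub, this]
    exact (smul_neg (q - q⁻¹)⁻¹ (qdiag q (-1) 1 0 a - qdiag q 1 (-1) 0 a)).symm.trans
      (by rw [neg_sub])

theorem exists_efDesc (hq : q ≠ 0) (hq' : ∀ N : ℕ, 0 < N → q ^ N ≠ 1) (h : KCond15 q π) :
    ∃ a₂ b₃ : ℂ, a₂ ≠ 0 ∧ b₃ ≠ 0 ∧ EFDesc15 q π a₂ b₃ := by
  obtain ⟨a, ha, e11, e12, e13, f11, f12, f13⟩ := (h.isNode hq).eval hq hq'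
  obtain ⟨b, hb, f23, f22, f21, e23, e22, e21⟩ := (h.isNode_rev hq).eval hq hq'
  simp only [LinearMap.comp_apply, rev_Z1, rev_Z2, rev_Z3] at f23 f22 f21 e23 e22 e21
  have key {x y : QSpace q 3} (hxy : rev q x = y) : x = rev q y := by rw [← hxy, rev_rev]
  refine ⟨a, b⁻¹, ha, inv_ne_zero hb, e11, e12, e13, ?_, ?_, ?_, f11, f12, f13, ?_, ?_, ?_⟩
  · simpa using key e21
  · simpa using key e22
  · simpa using key e23
  · simpa using key f21
  · simpa using key f22
  · simpa using key f23

end KCond15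

/-! ### Existence -/

/-- The symmetric `q`-integer `[n] = (q ^ n - q ^ (-n)) / (q - q⁻¹)`. -/
def qInt (q : ℂ) (n : ℕ) : ℂ := (q - q⁻¹)⁻¹ * (q ^ n - (q ^ n)⁻¹)

@[simp] theorem qInt_zero : qInt q 0 = 0 := by simp [qInt]

theorem qInt_one (h : q - q⁻¹ ≠ 0) : qInt q 1 = 1 := by simp [qInt, h]

theorem qInt_add_two (hq : q ≠ 0) (n : ℕ) :
    qInt q (n + 2) = (q + q⁻¹) * qInt q (n + 1) - qInt q n := by
  simp only [qInt]
  generalize (q - q⁻¹)⁻¹ = d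
  field_simp
  ring

theorem qInt_mul_sub (h : q - q⁻¹ ≠ 0) (hq : q ≠ 0) (m n : ℕ) :
    qInt q m * qInt q (n + 1) - qInt q n * qInt q (m + 1) =
      (q - q⁻¹)⁻¹ * (q ^ m * (q ^ n)⁻¹ - (q ^ m)⁻¹ * q ^ n) := by
  have hd : (q - q⁻¹)⁻¹ * (q - q⁻¹) = 1 := inv_mul_cancel₀ h
  simp only [qInt]
  generalize (q - q⁻¹)⁻¹ = d at hd
  trans d * (d * (q - q⁻¹)) * (q ^ m * (q ^ n)⁻¹ - (q ^ m)⁻¹ * q ^ n)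
  · field_simp
    ring
  · rw [hd, mul_one]

/-- The action of `e₁` on the quantum `3`-space, with `e₁ x₂ = x₁`. -/
def raise₁ (q : ℂ) : QSpace q 3 →ₗ[ℂ] QSpace q 3 :=
  (pbw q).constr ℂ fun p ↦ qInt q p.2.1 • qmono q (p.1 + 1, p.2.1 - 1, p.2.2)

/-- The action of `e₂` on the quantum `3`-space, with `e₂ x₃ = x₂`. -/
def raise₂ (q : ℂ) : QSpace q 3 →ₗ[ℂ] QSpace q 3 :=
  (pbw q).constr ℂ fun p ↦ qInt q p.2.2 • qmono q (p.1, p.2.1 + 1, p.2.2 - 1)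

/-- The action of `f₁` on the quantum `3`-space, with `f₁ x₁ = x₂`. -/
def lower₁ (q : ℂ) : QSpace q 3 →ₗ[ℂ] QSpace q 3 :=
  (pbw q).constr ℂ fun p ↦ qInt q p.1 • qmono q (p.1 - 1, p.2.1 + 1, p.2.2)

/-- The action of `f₂` on the quantum `3`-space, with `f₂ x₂ = x₃`. -/
def lower₂ (q : ℂ) : QSpace q 3 →ₗ[ℂ] QSpace q 3 :=
  (pbw q).constr ℂ fun p ↦ qInt q p.2.1 • qmono q (p.1, p.2.1 - 1, p.2.2 + 1)

@[simp] theorem raise₁_qmono (p : ℕ × ℕ × ℕ) :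
    raise₁ q (qmono q p) = qInt q p.2.1 • qmono q (p.1 + 1, p.2.1 - 1, p.2.2) := by
  rw [← pbw_apply, raise₁, Module.Basis.constr_basis]

@[simp] theorem raise₂_qmono (p : ℕ × ℕ × ℕ) :
    raise₂ q (qmono q p) = qInt q p.2.2 • qmono q (p.1, p.2.1 + 1, p.2.2 - 1) := by
  rw [← pbw_apply, raise₂, Module.Basis.constr_basis]

@[simp] theorem lower₁_qmono (p : ℕ × ℕ × ℕ) :
    lower₁ q (qmono q p) = qInt q p.1 • qmono q (p.1 - 1, p.2.1 + 1, p.2.2) := by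
  rw [← pbw_apply, lower₁, Module.Basis.constr_basis]

@[simp] theorem lower₂_qmono (p : ℕ × ℕ × ℕ) :
    lower₂ q (qmono q p) = qInt q p.2.1 • qmono q (p.1, p.2.1 - 1, p.2.2 + 1) := by
  rw [← pbw_apply, lower₂, Module.Basis.constr_basis]

theorem QSpace.linearMap_ext {D D' : QSpace q 3 →ₗ[ℂ] QSpace q 3}
    (h : ∀ a b c, D (qmono q (a, b, c)) = D' (qmono q (a, b, c))) (x : QSpace q 3) :
    D x = D' x :=
  DFunLike.congr_fun ((pbw q).ext fun ⟨a, b, c⟩ ↦ by simpa using h a b c) x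

theorem qdiag_qmono (i j l : ℤ) (p : ℕ × ℕ × ℕ) : qdiag q i j l (qmono q p) =
    ((q ^ i) ^ p.1 * (q ^ j) ^ p.2.1 * (q ^ l) ^ p.2.2) • qmono q p := scale_qmono ..

/-- A twisted Leibniz rule needs only be checked on ordered monomials. -/
theorem leibniz_of_qmono {D : QSpace q 3 →ₗ[ℂ] QSpace q 3}
    {σ τ : QSpace q 3 →ₐ[ℂ] QSpace q 3}
    (h : ∀ p r, D (qmono q p * qmono q r) =
      σ (qmono q p) * D (qmono q r) + D (qmono q p) * τ (qmono q r)) (a b : QSpace q 3) :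
    D (a * b) = σ a * D b + D a * τ b := by
  induction a using QSpace.mono_induction with
  | hmono p =>
    induction b using QSpace.mono_induction with
    | hmono r => exact h p r
    | hsmul c b hb => simp only [map_smul, mul_smul_comm, hb, smul_add]
    | hadd b b' hb hb' => simp only [map_add, mul_add, hb, hb', add_add_add_comm]
  | hsmul c a ha => simp only [map_smul, smul_mul_assoc, ha, smul_add]
  | hadd a a' ha ha' => simp only [map_add, add_mul, ha, ha', add_add_add_comm]

theorem raise₁_mul (hq : q ≠ 0) (x y : QSpace q 3) :
    raise₁ q (x * y) = x * raise₁ q y + raise₁ q x * qdiag q 1 (-1) 0 y := by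
  refine leibniz_of_qmono (σ := AlgHom.id ℂ _) (fun ⟨a, b, c⟩ ⟨a', b', c'⟩ ↦ ?_) x y
  rcases b with _ | b <;> rcases b' with _ | b' <;>
    simp [qmono_mul, qdiag_qmono, smul_smul, add_right_comm, ← add_assoc]
  all_goals
    match_scalars
    simp only [qInt]
    field_simp
    ring

theorem raise₂_mul (hq : q ≠ 0) (x y : QSpace q 3) :
    raise₂ q (x * y) = x * raise₂ q y + raise₂ q x * qdiag q 0 1 (-1) y := by
  refine leibniz_of_qmono (σ := AlgHom.id ℂ _) (fun ⟨a, b, c⟩ ⟨a', b', c'⟩ ↦ ?_) x y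
  rcases c with _ | c <;> rcases c' with _ | c' <;>
    simp [qmono_mul, qdiag_qmono, smul_smul, add_right_comm, ← add_assoc]
  all_goals
    match_scalars
    simp only [qInt]
    field_simp <;> ring

theorem lower₁_mul (hq : q ≠ 0) (x y : QSpace q 3) :
    lower₁ q (x * y) = qdiag q (-1) 1 0 x * lower₁ q y + lower₁ q x * y := by
  refine leibniz_of_qmono (τ := AlgHom.id ℂ _) (fun ⟨a, b, c⟩ ⟨a', b', c'⟩ ↦ ?_) x y
  rcases a with _ | a <;> rcases a' with _ | a' <;>
    simp [qmono_mul, qdiag_qmono, smul_smul, add_right_comm, ← add_assoc]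
  all_goals
    match_scalars
    simp only [qInt]
    field_simp <;> ring

theorem lower₂_mul (hq : q ≠ 0) (x y : QSpace q 3) :
    lower₂ q (x * y) = qdiag q 0 (-1) 1 x * lower₂ q y + lower₂ q x * y := by
  refine leibniz_of_qmono (τ := AlgHom.id ℂ _) (fun ⟨a, b, c⟩ ⟨a', b', c'⟩ ↦ ?_) x y
  rcases b with _ | b <;> rcases b' with _ | b' <;>
    simp [qmono_mul, qdiag_qmono, smul_smul, add_right_comm, ← add_assoc]
  all_goals
    match_scalars
    simp only [qInt]
    field_simp
    ring

theorem qdiag_raise₁ (hq : q ≠ 0) (i j l : ℤ) (x : QSpace q 3) :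
    qdiag q i j l (raise₁ q x) = q ^ (i - j) • raise₁ q (qdiag q i j l x) := by
  refine QSpace.linearMap_ext (D := (qdiag q i j l).toLinearMap ∘ₗ raise₁ q)
    (D' := q ^ (i - j) • (raise₁ q ∘ₗ (qdiag q i j l).toLinearMap)) (fun a b c ↦ ?_) x
  rcases b with _ | b <;> simp [qdiag_qmono, smul_smul, zpow_sub₀ hq]
  congr 1
  field_simp
  ring

theorem qdiag_raise₂ (hq : q ≠ 0) (i j l : ℤ) (x : QSpace q 3) :
    qdiag q i j l (raise₂ q x) = q ^ (j - l) • raise₂ q (qdiag q i j l x) := by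
  refine QSpace.linearMap_ext (D := (qdiag q i j l).toLinearMap ∘ₗ raise₂ q)
    (D' := q ^ (j - l) • (raise₂ q ∘ₗ (qdiag q i j l).toLinearMap)) (fun a b c ↦ ?_) x
  rcases c with _ | c <;> simp [qdiag_qmono, smul_smul, zpow_sub₀ hq]
  congr 1
  field_simp
  ring

theorem qdiag_lower₁ (hq : q ≠ 0) (i j l : ℤ) (x : QSpace q 3) :
    qdiag q i j l (lower₁ q x) = q ^ (j - i) • lower₁ q (qdiag q i j l x) := by
  refine QSpace.linearMap_ext (D := (qdiag q i j l).toLinearMap ∘ₗ lower₁ q)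
    (D' := q ^ (j - i) • (lower₁ q ∘ₗ (qdiag q i j l).toLinearMap)) (fun a b c ↦ ?_) x
  rcases a with _ | a <;> simp [qdiag_qmono, smul_smul, zpow_sub₀ hq]
  congr 1
  field_simp
  ring

theorem qdiag_lower₂ (hq : q ≠ 0) (i j l : ℤ) (x : QSpace q 3) :
    qdiag q i j l (lower₂ q x) = q ^ (l - j) • lower₂ q (qdiag q i j l x) := by
  refine QSpace.linearMap_ext (D := (qdiag q i j l).toLinearMap ∘ₗ lower₂ q)
    (D' := q ^ (l - j) • (lower₂ q ∘ₗ (qdiag q i j l).toLinearMap)) (fun a b c ↦ ?_) x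
  rcases b with _ | b <;> simp [qdiag_qmono, smul_smul, zpow_sub₀ hq]
  congr 1
  field_simp
  ring

theorem raise₁_lower₁ (h : q - q⁻¹ ≠ 0) (hq : q ≠ 0) (x : QSpace q 3) :
    raise₁ q (lower₁ q x) - lower₁ q (raise₁ q x) =
      (q - q⁻¹)⁻¹ • (qdiag q 1 (-1) 0 x - qdiag q (-1) 1 0 x) := by
  refine QSpace.linearMap_ext (D := raise₁ q ∘ₗ lower₁ q - lower₁ q ∘ₗ raise₁ q)
    (D' := (q - q⁻¹)⁻¹ • ((qdiag q 1 (-1) 0).toLinearMap - (qdiag q (-1) 1 0).toLinearMap))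
    (fun a b c ↦ ?_) x
  have := qInt_mul_sub h hq a b
  rcases a with _ | a <;> rcases b with _ | b <;>
    simp [qdiag_qmono, smul_smul]
  all_goals
    match_scalars
    try simp at this
    linear_combination this

theorem raise₂_lower₂ (h : q - q⁻¹ ≠ 0) (hq : q ≠ 0) (x : QSpace q 3) :
    raise₂ q (lower₂ q x) - lower₂ q (raise₂ q x) =
      (q - q⁻¹)⁻¹ • (qdiag q 0 1 (-1) x - qdiag q 0 (-1) 1 x) := by
  refine QSpace.linearMap_ext (D := raise₂ q ∘ₗ lower₂ q - lower₂ q ∘ₗ raise₂ q)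
    (D' := (q - q⁻¹)⁻¹ • ((qdiag q 0 1 (-1)).toLinearMap - (qdiag q 0 (-1) 1).toLinearMap))
    (fun a b c ↦ ?_) x
  have := qInt_mul_sub h hq b c
  rcases b with _ | b <;> rcases c with _ | c <;>
    simp [qdiag_qmono, smul_smul]
  all_goals
    match_scalars
    try simp at this
    linear_combination this

theorem raise₁_lower₂ (x : QSpace q 3) :
    raise₁ q (lower₂ q x) = lower₂ q (raise₁ q x) := by
  refine QSpace.linearMap_ext (D := raise₁ q ∘ₗ lower₂ q) (D' := lower₂ q ∘ₗ raise₁ q)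
    (fun a b c ↦ ?_) x
  simp [smul_smul]

theorem raise₂_lower₁ (x : QSpace q 3) :
    raise₂ q (lower₁ q x) = lower₁ q (raise₂ q x) := by
  refine QSpace.linearMap_ext (D := raise₂ q ∘ₗ lower₁ q) (D' := lower₁ q ∘ₗ raise₂ q)
    (fun a b c ↦ ?_) x
  simp [smul_smul, mul_comm]

/-- The quantum Serre relation between two operators on the quantum `3`-space. -/
def SerreRel (q : ℂ) (D D' : QSpace q 3 →ₗ[ℂ] QSpace q 3) : Prop :=
  ∀ x, D (D (D' x)) - (q + q⁻¹) • D (D' (D x)) + D' (D (D x)) = 0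

theorem SerreRel.smul {D D' : QSpace q 3 →ₗ[ℂ] QSpace q 3} (h : SerreRel q D D') (c c' : ℂ) :
    SerreRel q (c • D) (c' • D') := fun x ↦ by
  have := congrArg ((c * c * c') • ·) (h x)
  simp only [smul_zero] at this
  rw [← this]
  simp only [LinearMap.smul_apply, map_smul]
  module

theorem serreRel_of_qmono {D D' : QSpace q 3 →ₗ[ℂ] QSpace q 3}
    (h : ∀ a b c, D (D (D' (qmono q (a, b, c)))) - (q + q⁻¹) • D (D' (D (qmono q (a, b, c)))) +
      D' (D (D (qmono q (a, b, c)))) = 0) : SerreRel q D D' := fun x ↦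
  QSpace.linearMap_ext (D := D ∘ₗ D ∘ₗ D' - (q + q⁻¹) • (D ∘ₗ D' ∘ₗ D) + D' ∘ₗ D ∘ₗ D)
    (D' := 0) h x

theorem serreRel_raise₁_raise₂ (hq : q ≠ 0) : SerreRel q (raise₁ q) (raise₂ q) := by
  refine serreRel_of_qmono fun a b c ↦ ?_
  rcases b with _ | _ | b <;> rcases c with _ | c <;> simp [smul_smul]
  all_goals
    match_scalars
    simp only [qInt_add_two hq, qInt_zero]
    ring

theorem serreRel_raise₂_raise₁ (hq : q ≠ 0) : SerreRel q (raise₂ q) (raise₁ q) := by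
  refine serreRel_of_qmono fun a b c ↦ ?_
  rcases c with _ | _ | c <;> rcases b with _ | b <;> simp [smul_smul]
  all_goals
    match_scalars
    simp only [qInt_add_two hq, qInt_zero]
    ring

theorem serreRel_lower₁_lower₂ (hq : q ≠ 0) : SerreRel q (lower₁ q) (lower₂ q) := by
  refine serreRel_of_qmono fun a b c ↦ ?_
  rcases a with _ | _ | a <;> rcases b with _ | b <;> simp [smul_smul]
  all_goals
    match_scalars
    simp only [qInt_add_two hq, qInt_zero]
    ring

theorem serreRel_lower₂_lower₁ (hq : q ≠ 0) : SerreRel q (lower₂ q) (lower₁ q) := by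
  refine serreRel_of_qmono fun a b c ↦ ?_
  rcases b with _ | _ | b <;> rcases a with _ | a <;> simp [smul_smul]
  all_goals
    match_scalars
    simp only [qInt_add_two hq, qInt_zero]
    ring

theorem sub_inv_ne_zero (hq : q ≠ 0) (hq' : ∀ N : ℕ, 0 < N → q ^ N ≠ 1) : q - q⁻¹ ≠ 0 :=
  fun h ↦ hq' 2 two_pos <| by
    rw [sub_eq_zero] at h
    rw [pow_two]
    nth_rewrite 2 [h]
    exact mul_inv_cancel₀ hq

theorem cartan_two_ne_zero : ∀ i j, cartan 2 i j ≠ 0 := by decide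

/-- The diagonal automorphism `qdiag q i j l` as an equivalence. -/
def qdiagEquiv (hq : q ≠ 0) (i j l : ℤ) : QSpace q 3 ≃ₐ[ℂ] QSpace q 3 :=
  scaleEquiv q (Units.mk0 q hq ^ i) (Units.mk0 q hq ^ j) (Units.mk0 q hq ^ l)

@[simp] theorem qdiagEquiv_apply (hq : q ≠ 0) (i j l : ℤ) (x : QSpace q 3) :
    qdiagEquiv hq i j l x = qdiag q i j l x := by
  simp [qdiagEquiv, qdiag]

@[simp] theorem qdiagEquiv_symm_apply (hq : q ≠ 0) (i j l : ℤ) (x : QSpace q 3) :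
    (qdiagEquiv hq i j l).symm x = qdiag q (-i) (-j) (-l) x := by
  simp [qdiagEquiv, qdiag]

/-- The module-algebra structure with parameters `a₂ = a` and `b₃ = b`. -/
def uqslMA (hq : q ≠ 0) (h : q - q⁻¹ ≠ 0) {a b : ℂ} (ha : a ≠ 0) (hb : b ≠ 0) :
    UqslMA q 2 (QSpace q 3) where
  k := ![qdiagEquiv hq 1 (-1) 0, qdiagEquiv hq 0 1 (-1)]
  e := ![a • raise₁ q, b • raise₂ q]
  f := ![a⁻¹ • lower₁ q, b⁻¹ • lower₂ q]
  e_mul := Fin.forall_fin_two.2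
    ⟨fun x y ↦ by simp [raise₁_mul hq], fun x y ↦ by simp [raise₂_mul hq]⟩
  f_mul := Fin.forall_fin_two.2
    ⟨fun x y ↦ by simp [lower₁_mul hq], fun x y ↦ by simp [lower₂_mul hq]⟩
  e_one := by
    simp only [← qmono_zero]
    exact Fin.forall_fin_two.2 ⟨by simp, by simp⟩
  f_one := by
    simp only [← qmono_zero]
    exact Fin.forall_fin_two.2 ⟨by simp, by simp⟩
  k_comm := by simp [Fin.forall_fin_two, qdiag_qdiag hq]
  ke := by
    simp [Fin.forall_fin_two, cartan_two_zero_zero, cartan_two_zero_one, cartan_two_one_zero,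
      cartan_two_one_one, qdiag_raise₁ hq, qdiag_raise₂ hq, qdiag_qdiag hq, qdiag_zero,
      smul_comm a, smul_comm b]
  kf := by
    simp [Fin.forall_fin_two, cartan_two_zero_zero, cartan_two_zero_one, cartan_two_one_zero,
      cartan_two_one_one, qdiag_lower₁ hq, qdiag_lower₂ hq, qdiag_qdiag hq, qdiag_zero,
      smul_comm a⁻¹, smul_comm b⁻¹]
  ef := by
    simp [Fin.forall_fin_two, raise₁_lower₁ h hq, raise₂_lower₂ h hq, raise₁_lower₂,
      raise₂_lower₁, smul_smul, ha, hb, mul_comm]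
  ee_comm i j h := absurd h (cartan_two_ne_zero i j)
  ff_comm i j h := absurd h (cartan_two_ne_zero i j)
  serre_e := by
    simp only [Fin.forall_fin_two]
    exact ⟨⟨fun h ↦ by simp [cartan] at h, fun _ ↦ (serreRel_raise₁_raise₂ hq).smul a b⟩,
      fun _ ↦ (serreRel_raise₂_raise₁ hq).smul b a, fun h ↦ by simp [cartan] at h⟩
  serre_f := by
    simp only [Fin.forall_fin_two]
    exact ⟨⟨fun h ↦ by simp [cartan] at h, fun _ ↦ (serreRel_lower₁_lower₂ hq).smul a⁻¹ b⁻¹⟩,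
      fun _ ↦ (serreRel_lower₂_lower₁ hq).smul b⁻¹ a⁻¹, fun h ↦ by simp [cartan] at h⟩

theorem kCond15_uqslMA (hq : q ≠ 0) (h : q - q⁻¹ ≠ 0) {a b : ℂ} (ha : a ≠ 0) (hb : b ≠ 0) :
    KCond15 q (uqslMA hq h ha hb) := by
  simp [KCond15, uqslMA]

theorem efDesc15_uqslMA (hq : q ≠ 0) (h : q - q⁻¹ ≠ 0) {a b : ℂ} (ha : a ≠ 0) (hb : b ≠ 0) :
    EFDesc15 q (uqslMA hq h ha hb) a b := by
  simp [EFDesc15, uqslMA, Z1_eq_qmono, Z2_eq_qmono, Z3_eq_qmono, qInt_one h]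

/-! ### Normalization of the parameters -/

theorem linearMap_eq_of_leibniz {D D' : QSpace q 3 →ₗ[ℂ] QSpace q 3}
    {σ τ : QSpace q 3 →ₐ[ℂ] QSpace q 3}
    (hD : ∀ a b, D (a * b) = σ a * D b + D a * τ b)
    (hD' : ∀ a b, D' (a * b) = σ a * D' b + D' a * τ b)
    (h₀ : D 1 = D' 1) (h₁ : D (Z1 q) = D' (Z1 q)) (h₂ : D (Z2 q) = D' (Z2 q))
    (h₃ : D (Z3 q) = D' (Z3 q)) (a : QSpace q 3) : D a = D' a := by
  induction a using QSpace.gen_induction with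
  | hc c => rw [Algebra.algebraMap_eq_smul_one, map_smul, map_smul, h₀]
  | h₁ => exact h₁
  | h₂ => exact h₂
  | h₃ => exact h₃
  | hmul a b ha hb => rw [hD, hD', ha, hb]
  | hadd a b ha hb => rw [map_add, map_add, ha, hb]

theorem scale_qdiag (s t u : ℂ) (i j l : ℤ) (x : QSpace q 3) :
    scale q s t u (qdiag q i j l x) = qdiag q i j l (scale q s t u x) := by
  simp only [qdiag, scale_scale, mul_comm]

theorem UqslMA.iso_of_efDesc (hq : q ≠ 0) {π π' : UqslMA q 2 (QSpace q 3)} {a b : ℂ} (ha : a ≠ 0)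
    (hb : b ≠ 0) (h : KCond15 q π) (h' : KCond15 q π') (hd : EFDesc15 q π a b)
    (hd' : EFDesc15 q π' 1 1) : π.Iso π' := by
  let ψ := scaleEquiv q 1 (Units.mk0 a ha) (Units.mk0 a ha * Units.mk0 b hb)
  have ψ1 : ψ (Z1 q) = Z1 q := by simp [ψ]
  have ψ2 : ψ (Z2 q) = a • Z2 q := by simp [ψ]
  have ψ3 : ψ (Z3 q) = b • a • Z3 q := by simp [ψ, smul_smul, mul_comm]
  have ψ1' : ψ.symm (Z1 q) = Z1 q := by simp [ψ]
  have ψ2' : ψ.symm (Z2 q) = a⁻¹ • Z2 q := by simp [ψ]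
  have ψ3' : ψ.symm (Z3 q) = a⁻¹ • b⁻¹ • Z3 q := by simp [ψ, smul_smul, mul_comm]
  have hψ (i j l : ℤ) (x : QSpace q 3) : ψ (qdiag q i j l (ψ.symm x)) = qdiag q i j l x :=
    (scale_qdiag ..).trans (congrArg _ (ψ.apply_symm_apply x))
  have hk : ∀ i x, ψ (π.k i (ψ.symm x)) = π'.k i x := Fin.forall_fin_two.2
    ⟨fun x ↦ by rw [h.k_zero, h'.k_zero, hψ], fun x ↦ by rw [h.k_one, h'.k_one, hψ]⟩
  have hk' : ∀ i x, ψ ((π.k i).symm (ψ.symm x)) = (π'.k i).symm x := Fin.forall_fin_two.2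
    ⟨fun x ↦ by rw [h.k_zero_symm hq, h'.k_zero_symm hq, hψ],
      fun x ↦ by rw [h.k_one_symm hq, h'.k_one_symm hq, hψ]⟩
  obtain ⟨e11, e12, e13, e21, e22, e23, f11, f12, f13, f21, f22, f23⟩ := hd
  obtain ⟨e11', e12', e13', e21', e22', e23', f11', f12', f13', f21', f22', f23'⟩ := hd'
  refine ⟨ψ, hk, hk', fun i ↦ ?_, fun i ↦ ?_⟩
  · refine linearMap_eq_of_leibniz (D := ψ.toLinearMap ∘ₗ π.e i ∘ₗ ψ.symm.toLinearMap)
      (D' := π'.e i) (σ := AlgHom.id ℂ _) (τ := (π'.k i : QSpace q 3 →ₐ[ℂ] QSpace q 3))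
      (fun x y ↦ ?_) (π'.e_mul i) ?_ ?_ ?_ ?_
    · simp [π.e_mul, hk]
    · simp [π.e_one, π'.e_one]
    all_goals
      revert i
      simp [Fin.forall_fin_two, *]
  · refine linearMap_eq_of_leibniz (D := ψ.toLinearMap ∘ₗ π.f i ∘ₗ ψ.symm.toLinearMap)
      (D' := π'.f i) (σ := ((π'.k i).symm : QSpace q 3 →ₐ[ℂ] QSpace q 3)) (τ := AlgHom.id ℂ _)
      (fun x y ↦ ?_) (π'.f_mul i) ?_ ?_ ?_ ?_
    · simp [π.f_mul, hk']
    · simp [π.f_one, π'.f_one]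
    all_goals
      revert i
      simp [Fin.forall_fin_two, *]

end QuantumSpace

/-- Classification of `U_q(sl(3))`-module-algebra structures on `A_q(3)` in case
`(A4)|(B5)`: description, converse existence, and isomorphism with the normalized one. -/
theorem Uqsl3_on_Aq3_A4B5 (q : ℂ) (hq : q ≠ 0)
    (hq' : ∀ N : ℕ, 0 < N → q ^ N ≠ 1) :
    (∀ π : UqslMA q 2 (QSpace q 3), KCond15 q π →
      ∃ a₂ b₃ : ℂ, a₂ ≠ 0 ∧ b₃ ≠ 0 ∧ EFDesc15 q π a₂ b₃) ∧
    (∀ a₂ b₃ : ℂ, a₂ ≠ 0 → b₃ ≠ 0 →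
      ∃ π : UqslMA q 2 (QSpace q 3), KCond15 q π ∧ EFDesc15 q π a₂ b₃) ∧
    (∀ π π' : UqslMA q 2 (QSpace q 3),
      KCond15 q π → KCond15 q π' → EFDesc15 q π' 1 1 → π.Iso π') := by
  have h := sub_inv_ne_zero hq hq'
  refine ⟨fun π hπ ↦ hπ.exists_efDesc hq hq', fun a b ha hb ↦ ⟨uqslMA hq h ha hb,
    kCond15_uqslMA hq h ha hb, efDesc15_uqslMA hq h ha hb⟩, fun π π' hπ hπ' hd' ↦ ?_⟩
  obtain ⟨a, b, ha, hb, hd⟩ := hπ.exists_efDesc hq hq'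
  exact UqslMA.iso_of_efDesc hq ha hb hπ hπ' hd hd'
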